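/- For all positive definite n×n complex matrices ρ, σ and every γ ∈ (0,1): (1/(1−γ))·D^{max}(ρ‖σ #_γ ρ) = D^{max}(ρ‖σ); explicitly, (1/(1−γ))·Tr[ρ·log(ρ^{1/2}·(σ #_γ ρ)^{-1}·ρ^{1/2})] = Tr[ρ·log(ρ^{1/2}·σ^{-1}·ρ^{1/2})]. (The γ-weighted geometric version of the maximal relative entropy coincides with the maximal relative entropy itself.) -/

import Mathlib

open Matrix
open scoped ComplexOrder

/-- Functional calculus for Hermitian matrices: apply `f : ℝ → ℝ` to the eigenvalues
in a spectral decomposition (and return `0` on non-Hermitian input). -/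
noncomputable def mfun {ι : Type*} [Fintype ι] [DecidableEq ι]
    (f : ℝ → ℝ) (A : Matrix ι ι ℂ) : Matrix ι ι ℂ :=
  letI := Classical.propDecidable A.IsHermitian
  if hA : A.IsHermitian then hA.cfc f else 0

/-- Real matrix power `A ^ γ` via functional calculus (with `Real.rpow` on eigenvalues,
so that `0 ^ γ = 0` for `γ ≠ 0`, giving the generalized inverse for `γ = -1`). -/
noncomputable def mpow {ι : Type*} [Fintype ι] [DecidableEq ι]
    (A : Matrix ι ι ℂ) (γ : ℝ) : Matrix ι ι ℂ :=
  mfun (fun x => x ^ γ) A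

/-- The `γ`-weighted geometric mean
`σ #_γ ρ := σ^{1/2} · (σ^{-1/2} · ρ · σ^{-1/2})^γ · σ^{1/2}`. -/
noncomputable def geomMean {ι : Type*} [Fintype ι] [DecidableEq ι]
    (σ ρ : Matrix ι ι ℂ) (γ : ℝ) : Matrix ι ι ℂ :=
  mpow σ (1 / 2) * mpow (mpow σ (-(1 / 2)) * ρ * mpow σ (-(1 / 2))) γ * mpow σ (1 / 2)

/-- The Belavkin-Staszewski (maximal) relative entropy
`D^max(ω‖τ) := Tr[ω · log(ω^{1/2} · τ⁻¹ · ω^{1/2})]` of positive definite matrices. -/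
noncomputable def Dmax {ι : Type*} [Fintype ι] [DecidableEq ι]
    (ω τ : Matrix ι ι ℂ) : ℝ :=
  ((ω * mfun Real.log (mpow ω (1 / 2) * mpow τ (-1) * mpow ω (1 / 2))).trace).re

/-- The functional calculus `mfun` agrees with Mathlib's continuous functional calculus. -/
lemma mfun_eq_cfc {ι : Type*} [Fintype ι] [DecidableEq ι] (f : ℝ → ℝ) (A : Matrix ι ι ℂ) :
    mfun f A = cfc f A := by
  unfold mfun
  split_ifs with hA
  · exact (hA.cfc_eq f).symm
  · exact (cfc_apply_of_not_predicate A hA).symm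

lemma mfun_isHermitian {ι : Type*} [Fintype ι] [DecidableEq ι] (f : ℝ → ℝ) (A : Matrix ι ι ℂ) :
    (mfun f A).IsHermitian := by
  rw [mfun_eq_cfc]
  exact cfc_predicate f A

/-- If `K` intertwines two Hermitian matrices, it intertwines all functions of them. -/
lemma mfun_semiconjBy {ι : Type*} [Fintype ι] [DecidableEq ι] {K A B : Matrix ι ι ℂ}
    (hA : A.IsHermitian) (hB : B.IsHermitian) (h : SemiconjBy K A B) (f : ℝ → ℝ) :
    SemiconjBy K (mfun f A) (mfun f B) := by
  classical
  let S : Finset ℝ := A.finite_real_spectrum.toFinset ∪ B.finite_real_spectrum.toFinset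
  let q : Polynomial ℝ := Lagrange.interpolate S id f
  have hq : ∀ x ∈ S, f x = q.eval x := fun x hx =>
    (Lagrange.eval_interpolate_at_node f (Set.injOn_id _) hx).symm
  have hfA : mfun f A = Polynomial.aeval A q := by
    rw [mfun_eq_cfc, cfc_congr (g := q.eval) fun x hx => hq x (by simp [S, hx])]
    exact cfc_polynomial q A hA
  have hfB : mfun f B = Polynomial.aeval B q := by
    rw [mfun_eq_cfc, cfc_congr (g := q.eval) fun x hx => hq x (by simp [S, hx])]
    exact cfc_polynomial q B hB
  rw [hfA, hfB]
  induction q using Polynomial.induction_on' with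
  | add p q hp hq => simpa using hp.add_right hq
  | monomial n a =>
    simp only [Polynomial.aeval_monomial]
    exact SemiconjBy.mul_right (Algebra.commutes a K).symm (h.pow_right n)

lemma Matrix.PosDef.spectrum_real_pos {ι : Type*} [Fintype ι] [DecidableEq ι]
    {A : Matrix ι ι ℂ} (hA : A.PosDef) {x : ℝ} (hx : x ∈ spectrum ℝ A) : 0 < x := by
  rw [hA.isHermitian.spectrum_real_eq_range_eigenvalues] at hx
  obtain ⟨i, rfl⟩ := hx
  exact hA.eigenvalues_pos i

lemma mpow_add {ι : Type*} [Fintype ι] [DecidableEq ι] {A : Matrix ι ι ℂ} (hA : A.PosDef)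
    (a b : ℝ) : mpow A (a + b) = mpow A a * mpow A b := by
  simp only [mpow, mfun_eq_cfc]
  rw [← cfc_mul _ _ A (A.finite_real_spectrum.continuousOn _)
    (A.finite_real_spectrum.continuousOn _)]
  exact cfc_congr fun x hx => Real.rpow_add (hA.spectrum_real_pos hx) a b

lemma mpow_zero {ι : Type*} [Fintype ι] [DecidableEq ι] {A : Matrix ι ι ℂ}
    (hA : A.IsHermitian) : mpow A 0 = 1 := by
  simp only [mpow, mfun_eq_cfc, Real.rpow_zero]
  exact cfc_const_one ℝ A hA

lemma mpow_one {ι : Type*} [Fintype ι] [DecidableEq ι] {A : Matrix ι ι ℂ}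
    (hA : A.IsHermitian) : mpow A 1 = A := by
  simp only [mpow, mfun_eq_cfc, Real.rpow_one]
  exact cfc_id' ℝ A hA

lemma mpow_isHermitian {ι : Type*} [Fintype ι] [DecidableEq ι] (A : Matrix ι ι ℂ) (a : ℝ) :
    (mpow A a).IsHermitian :=
  mfun_isHermitian _ A

lemma mpow_neg_mul_mpow {ι : Type*} [Fintype ι] [DecidableEq ι] {A : Matrix ι ι ℂ}
    (hA : A.PosDef) (a : ℝ) : mpow A (-a) * mpow A a = 1 := by
  rw [← mpow_add hA, neg_add_cancel, mpow_zero hA.isHermitian]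

lemma mpow_mul_mpow_neg {ι : Type*} [Fintype ι] [DecidableEq ι] {A : Matrix ι ι ℂ}
    (hA : A.PosDef) (a : ℝ) : mpow A a * mpow A (-a) = 1 := by
  rw [← mpow_add hA, add_neg_cancel, mpow_zero hA.isHermitian]

lemma mpow_isUnit {ι : Type*} [Fintype ι] [DecidableEq ι] {A : Matrix ι ι ℂ}
    (hA : A.PosDef) (a : ℝ) : IsUnit (mpow A a) :=
  ⟨⟨_, _, mpow_mul_mpow_neg hA a, mpow_neg_mul_mpow hA a⟩, rfl⟩

lemma mpow_half_mul_self {ι : Type*} [Fintype ι] [DecidableEq ι] {A : Matrix ι ι ℂ}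
    (hA : A.PosDef) : mpow A (1 / 2) * mpow A (1 / 2) = A := by
  rw [← mpow_add hA, add_halves, mpow_one hA.isHermitian]

lemma mpow_neg_one_eq_of_mul_eq_one {ι : Type*} [Fintype ι] [DecidableEq ι]
    {A B : Matrix ι ι ℂ} (hA : A.PosDef) (h : A * B = 1) : mpow A (-1) = B := by
  refine left_inv_eq_right_inv ?_ h
  simpa only [mpow_one hA.isHermitian] using mpow_neg_mul_mpow hA 1

/-- Congruence by an invertible Hermitian matrix preserves positive definiteness. -/
lemma Matrix.PosDef.mul_mul_same {ι : Type*} [Fintype ι] [DecidableEq ι]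
    {A B : Matrix ι ι ℂ} (hA : A.PosDef) (hB : B.IsHermitian) (hU : IsUnit B) :
    (B * A * B).PosDef := by
  have h := (hU.posDef_star_left_conjugate_iff (x := A)).2 hA
  rwa [star_eq_conjTranspose, hB.eq] at h

lemma mpow_posDef {ι : Type*} [Fintype ι] [DecidableEq ι] {A : Matrix ι ι ℂ}
    (hA : A.PosDef) (a : ℝ) : (mpow A a).PosDef := by
  have h := PosDef.one.mul_mul_same (mpow_isHermitian A (a / 2)) (mpow_isUnit hA (a / 2))
  rwa [mul_one, ← mpow_add hA, add_halves] at h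

lemma mfun_log_mpow {ι : Type*} [Fintype ι] [DecidableEq ι] {A : Matrix ι ι ℂ}
    (hA : A.PosDef) (a : ℝ) : mfun Real.log (mpow A a) = a • mfun Real.log A := by
  have hfin := A.finite_real_spectrum
  simp only [mpow, mfun_eq_cfc]
  refine (cfc_comp' Real.log (fun x => x ^ a) A ((hfin.image _).continuousOn _)
    (hfin.continuousOn _) hA.isHermitian).symm.trans ?_
  rw [← cfc_smul a Real.log A (hfin.continuousOn _)]
  exact cfc_congr fun x hx => Real.log_rpow (hA.spectrum_real_pos hx) a

lemma geomMean_posDef {ι : Type*} [Fintype ι] [DecidableEq ι] {σ ρ : Matrix ι ι ℂ}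
    (hσ : σ.PosDef) (hρ : ρ.PosDef) (γ : ℝ) : (geomMean σ ρ γ).PosDef :=
  (mpow_posDef (hρ.mul_mul_same (mpow_isHermitian σ _) (mpow_isUnit hσ _)) γ).mul_mul_same
    (mpow_isHermitian σ _) (mpow_isUnit hσ _)

lemma mpow_geomMean_neg_one {ι : Type*} [Fintype ι] [DecidableEq ι] {σ ρ : Matrix ι ι ℂ}
    (hσ : σ.PosDef) (hρ : ρ.PosDef) (γ : ℝ) :
    mpow (geomMean σ ρ γ) (-1) =
      mpow σ (-(1 / 2)) * mpow (mpow σ (-(1 / 2)) * ρ * mpow σ (-(1 / 2))) (-γ) *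
        mpow σ (-(1 / 2)) := by
  refine mpow_neg_one_eq_of_mul_eq_one (geomMean_posDef hσ hρ γ) ?_
  have hM := hρ.mul_mul_same (mpow_isHermitian σ (-(1 / 2))) (mpow_isUnit hσ (-(1 / 2)))
  unfold geomMean
  set M := mpow σ (-(1 / 2)) * ρ * mpow σ (-(1 / 2))
  calc mpow σ (1 / 2) * mpow M γ * mpow σ (1 / 2) *
        (mpow σ (-(1 / 2)) * mpow M (-γ) * mpow σ (-(1 / 2)))
      = mpow σ (1 / 2) * (mpow M γ * (mpow σ (1 / 2) * mpow σ (-(1 / 2))) * mpow M (-γ)) *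
          mpow σ (-(1 / 2)) := by simp only [mul_assoc]
    _ = 1 := by
      rw [mpow_mul_mpow_neg hσ, mul_one, mpow_mul_mpow_neg hM, mul_one, mpow_mul_mpow_neg hσ]

/-- The relative operator `ρ^{1/2} τ⁻¹ ρ^{1/2}` for `τ = σ #_γ ρ` is the `(1 - γ)`-th power of the
one for `τ = σ`. -/
lemma mpow_half_mul_geomMean_inv_mul {ι : Type*} [Fintype ι] [DecidableEq ι]
    {σ ρ : Matrix ι ι ℂ} (hσ : σ.PosDef) (hρ : ρ.PosDef) (γ : ℝ) :
    mpow ρ (1 / 2) * mpow (geomMean σ ρ γ) (-1) * mpow ρ (1 / 2) =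
      mpow (mpow ρ (1 / 2) * mpow σ (-1) * mpow ρ (1 / 2)) (1 - γ) := by
  have hM := hρ.mul_mul_same (mpow_isHermitian σ (-(1 / 2))) (mpow_isUnit hσ (-(1 / 2)))
  have hX := (mpow_posDef hσ (-1)).mul_mul_same (mpow_isHermitian ρ (1 / 2))
    (mpow_isUnit hρ (1 / 2))
  have htt : mpow σ (-1) = mpow σ (-(1 / 2)) * mpow σ (-(1 / 2)) := by
    rw [← mpow_add hσ]
    norm_num
  have hrr := mpow_half_mul_self hρ
  rw [mpow_geomMean_neg_one hσ hρ]
  set t := mpow σ (-(1 / 2))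
  set r := mpow ρ (1 / 2)
  set M := t * ρ * t with hMdef
  set X := r * mpow σ (-1) * r with hXdef
  have hK : SemiconjBy (r * t) M X := by
    simp only [SemiconjBy, hMdef, hXdef, htt, ← hrr, mul_assoc]
  have hKγ : r * t * mpow M (-γ) = mpow X (-γ) * (r * t) :=
    mfun_semiconjBy hM.isHermitian hX.isHermitian hK _
  calc r * (t * mpow M (-γ) * t) * r = r * t * mpow M (-γ) * (t * r) := by
        simp only [mul_assoc]
    _ = mpow X (-γ) * X := by rw [hKγ, hXdef, htt]; simp only [mul_assoc]
    _ = mpow X (-γ) * mpow X 1 := by rw [mpow_one hX.isHermitian]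
    _ = mpow X (1 - γ) := by rw [← mpow_add hX, neg_add_eq_sub]

/-- For positive definite `ρ, σ` and `γ ∈ (0,1)`, the `γ`-weighted geometric version of the
maximal relative entropy coincides with the maximal relative entropy itself:
`(1/(1-γ)) · D^max(ρ‖σ #_γ ρ) = D^max(ρ‖σ)`. -/
theorem Dmax_geomMean_eq {n : ℕ} (ρ σ : Matrix (Fin n) (Fin n) ℂ)
    (hρ : ρ.PosDef) (hσ : σ.PosDef) (γ : ℝ) (hγ : γ ∈ Set.Ioo (0 : ℝ) 1) :
    (1 / (1 - γ)) * Dmax ρ (geomMean σ ρ γ) = Dmax ρ σ := by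
  have hX := (mpow_posDef hσ (-1)).mul_mul_same (mpow_isHermitian ρ (1 / 2))
    (mpow_isUnit hρ (1 / 2))
  have hγ' : 1 - γ ≠ 0 := (sub_pos.2 hγ.2).ne'
  simp only [Dmax]
  rw [mpow_half_mul_geomMean_inv_mul hσ hρ, mfun_log_mpow hX, mul_smul_comm, trace_smul,
    Complex.smul_re, smul_eq_mul, ← mul_assoc, one_div_mul_cancel hγ', one_mul]
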